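/- Let α = (a_1, …, a_r) and β = (b_1, …, b_r) be tuples in (B_n)^r that are simultaneously conjugate (there exists x ∈ B_n with x^{-1} a_i x = b_i for all i), and let J = (j_1, …, j_r) ∈ ℤ^r with j_i = min(inf(a_i), inf(b_i)). Then α, β ∈ C_J, and there exists a finite chain of tuples α = α_1, α_2, …, α_{k+1} = β, all lying in C_J and all simultaneously conjugate to α, together with simple elements s_1, …, s_k such that s_j^{-1} α_j s_j = α_{j+1} for every j, where each s_j is ≼-minimal among the nontrivial simple elements conjugating α_j into C_J. -/

import Mathlib

/-- The braid relations on `n` strands, with Artin generators indexed by `Fin (n-1)`: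
`σᵢ σⱼ σᵢ = σⱼ σᵢ σⱼ` when `|i - j| = 1`, and `σᵢ σⱼ = σⱼ σᵢ` when `|i - j| ≥ 2`. -/
def braidRels (n : ℕ) : Set (FreeGroup (Fin (n - 1))) :=
  {w | (∃ i j : Fin (n - 1), (i : ℕ) + 1 = (j : ℕ) ∧
          w = FreeGroup.of i * FreeGroup.of j * FreeGroup.of i *
              (FreeGroup.of j * FreeGroup.of i * FreeGroup.of j)⁻¹) ∨
       (∃ i j : Fin (n - 1), (i : ℕ) + 1 < (j : ℕ) ∧
          w = FreeGroup.of i * FreeGroup.of j * (FreeGroup.of j * FreeGroup.of i)⁻¹)}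

/-- The braid group `B_n` on `n` strands. -/
abbrev BraidGroup (n : ℕ) := PresentedGroup (braidRels n)

/-- The Artin generator `σᵢ` of the braid group. -/
def braidGen (n : ℕ) (i : Fin (n - 1)) : BraidGroup n := PresentedGroup.of i

/-- The monoid `B_n⁺` of positive braids: products of the generators with no inverses. -/
def PosBraid (n : ℕ) : Submonoid (BraidGroup n) :=
  Submonoid.closure (Set.range (braidGen n))

/-- Prefix order (left-divisibility): `a ≼ b` iff `a * c = b` for some positive `c`. -/
def PrefixLE (n : ℕ) (a b : BraidGroup n) : Prop :=
  ∃ c ∈ PosBraid n, a * c = b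

/-- The Garside half-twist `Δ = (σ₁)(σ₂σ₁)⋯(σ_{n-1}⋯σ₁)`. -/
def braidDelta (n : ℕ) : BraidGroup n :=
  ((List.finRange (n - 1)).map (fun k =>
      ((((List.finRange (n - 1)).filter (fun i => decide (i ≤ k))).reverse.map
        (braidGen n)).prod))).prod

/-- A simple element (permutation braid): a positive braid left-dividing `Δ`. -/
def IsSimple (n : ℕ) (s : BraidGroup n) : Prop :=
  s ∈ PosBraid n ∧ PrefixLE n s (braidDelta n)

/-- `InfGE n j a` means `inf(a) ≥ j`, i.e. `a = Δ^j p` for some positive braid `p`. -/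
def InfGE (n : ℕ) (j : ℤ) (a : BraidGroup n) : Prop :=
  ∃ p ∈ PosBraid n, a = braidDelta n ^ j * p

/-- `β ∈ C^inf(α)`: `inf(β i) ≥ inf(α i)` for all `i` and `β` is simultaneously
conjugate to `α`. -/
def CInf (n r : ℕ) (α β : Fin r → BraidGroup n) : Prop :=
  (∀ i, ∀ j : ℤ, InfGE n j (α i) → InfGE n j (β i)) ∧
  ∃ ω : BraidGroup n, ∀ i, β i = ω⁻¹ * α i * ω

/-- `δ ∈ C_J`: `inf(δ i) ≥ J i` for all `i`. -/
def CJ (n r : ℕ) (J : Fin r → ℤ) (δ : Fin r → BraidGroup n) : Prop :=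
  ∀ i, InfGE n (J i) (δ i)

/-- Property `P(δ,J)` for a braid `s`: `inf(s⁻¹ δᵢ s) ≥ J i` for all `i`,
i.e. `s⁻¹ δ s ∈ C_J`. -/
def PropP (n r : ℕ) (J : Fin r → ℤ) (δ : Fin r → BraidGroup n) (s : BraidGroup n) : Prop :=
  ∀ i, InfGE n (J i) (s⁻¹ * δ i * s)

/-- `s ∈ S_{δ,J}`: `s` is ≼-minimal among the nontrivial simple elements
satisfying `P(δ,J)`. -/
def MinSimple (n r : ℕ) (J : Fin r → ℤ) (δ : Fin r → BraidGroup n) (s : BraidGroup n) : Prop :=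
  IsSimple n s ∧ s ≠ 1 ∧ PropP n r J δ s ∧
    ∀ t : BraidGroup n, IsSimple n t → t ≠ 1 → PropP n r J δ t → PrefixLE n t s → t = s

/-- `d` is a greatest common left-divisor of `u` and `v` in `B_n⁺`. -/
def IsGCD (n : ℕ) (u v d : BraidGroup n) : Prop :=
  d ∈ PosBraid n ∧ PrefixLE n d u ∧ PrefixLE n d v ∧
    ∀ c ∈ PosBraid n, PrefixLE n c u → PrefixLE n c v → PrefixLE n c d

/-- `m` is a least common left-multiple of `u` and `v` in `B_n⁺`. -/
def IsLCM (n : ℕ) (u v m : BraidGroup n) : Prop :=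
  m ∈ PosBraid n ∧ PrefixLE n u m ∧ PrefixLE n v m ∧
    ∀ c ∈ PosBraid n, PrefixLE n u c → PrefixLE n v c → PrefixLE n m c

/-- The defining relations of the simply laced Artin monoid of a graph. -/
inductive ArtinRel {ι : Type*} (Γ : SimpleGraph ι) : FreeMonoid ι → FreeMonoid ι → Prop
  | braid (i j : ι) : Γ.Adj i j → ArtinRel Γ (.of i * (.of j * .of i)) (.of j * (.of i * .of j))
  | comm (i j : ι) : i ≠ j → ¬ Γ.Adj i j → ArtinRel Γ (.of i * .of j) (.of j * .of i)

/-- The simply laced Artin monoid of a graph. -/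
abbrev ArtinMonoid {ι : Type*} (Γ : SimpleGraph ι) := PresentedMonoid (ArtinRel Γ)

namespace ArtinMonoid

variable {ι : Type*} {Γ : SimpleGraph ι}

/-- The generators of the Artin monoid. -/
def gen (Γ : SimpleGraph ι) (i : ι) : ArtinMonoid Γ := PresentedMonoid.of _ i

theorem gen_braid {i j : ι} (h : Γ.Adj i j) (x : ArtinMonoid Γ) :
    gen Γ i * (gen Γ j * (gen Γ i * x)) = gen Γ j * (gen Γ i * (gen Γ j * x)) := by
  have := PresentedMonoid.mk_eq_mk_of_rel (ArtinRel.braid i j h)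
  simp only [map_mul] at this
  simpa only [mul_assoc, gen, PresentedMonoid.of] using congrArg (· * x) this

theorem gen_comm {i j : ι} (hij : i ≠ j) (h : ¬ Γ.Adj i j) (x : ArtinMonoid Γ) :
    gen Γ i * (gen Γ j * x) = gen Γ j * (gen Γ i * x) := by
  have := PresentedMonoid.mk_eq_mk_of_rel (ArtinRel.comm i j hij h)
  simp only [map_mul] at this
  simpa only [mul_assoc, gen, PresentedMonoid.of] using congrArg (· * x) this

/-- The length homomorphism of the Artin monoid. -/
def lenHom (Γ : SimpleGraph ι) : ArtinMonoid Γ →* Multiplicative ℕ :=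
  PresentedMonoid.lift (fun _ => Multiplicative.ofAdd 1) (by
    rintro a b (⟨i, j, h⟩ | ⟨i, j, h, h'⟩) <;> simp)

/-- The length of an element of the Artin monoid. -/
def len (a : ArtinMonoid Γ) : ℕ := (lenHom Γ a).toAdd

@[simp] theorem len_gen_mul (i : ι) (a : ArtinMonoid Γ) : len (gen Γ i * a) = len a + 1 := by
  have : lenHom Γ (gen Γ i) = Multiplicative.ofAdd 1 := rfl
  simp [len, this, add_comm]

/-- `i * a = j * b` is a right multiple of the least common multiple of the generators
`i` and `j`. -/
inductive Complement (Γ : SimpleGraph ι) : ι → ι → ArtinMonoid Γ → ArtinMonoid Γ → Prop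
  | same (i : ι) (a : ArtinMonoid Γ) : Complement Γ i i a a
  | comm (i j : ι) (c : ArtinMonoid Γ) : i ≠ j → ¬ Γ.Adj i j →
      Complement Γ i j (gen Γ j * c) (gen Γ i * c)
  | braid (i j : ι) (c : ArtinMonoid Γ) : Γ.Adj i j →
      Complement Γ i j (gen Γ j * (gen Γ i * c)) (gen Γ i * (gen Γ j * c))

theorem Complement.symm {i j : ι} {a b : ArtinMonoid Γ} (h : Complement Γ i j a b) :
    Complement Γ j i b a := by
  rcases h with _ | ⟨_, _, h, h'⟩ | ⟨_, _, h⟩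
  · exact .same _ _
  · exact .comm _ _ _ h.symm fun h => h' h.symm
  · exact .braid _ _ _ h.symm

theorem Complement.mul_right {i j : ι} {a b : ArtinMonoid Γ} (h : Complement Γ i j a b)
    (x : ArtinMonoid Γ) : Complement Γ i j (a * x) (b * x) := by
  rcases h with _ | ⟨_, _, h, h'⟩ | ⟨_, _, h⟩
  · exact .same _ _
  · simpa only [mul_assoc] using .comm _ _ _ h h'
  · simpa only [mul_assoc] using .braid _ _ _ h

/-- All equal products of a generator and an element of length less than `L` are multiples of the
least common multiple of their initial generators. -/
def ComplementBelow (Γ : SimpleGraph ι) (L : ℕ) : Prop :=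
  ∀ ⦃i j : ι⦄ ⦃a b : ArtinMonoid Γ⦄, len a < L → gen Γ i * a = gen Γ j * b → Complement Γ i j a b

theorem ComplementBelow.cancel {L : ℕ} (H : ComplementBelow Γ L) {i : ι} {a b : ArtinMonoid Γ}
    (ha : len a < L) (h : gen Γ i * a = gen Γ i * b) : a = b := by
  cases H ha h
  · rfl
  · exact absurd rfl ‹i ≠ i›
  · exact absurd ‹Γ.Adj i i› Γ.irrefl

theorem ComplementBelow.of_comm {L : ℕ} (H : ComplementBelow Γ L) {i j : ι} {a b : ArtinMonoid Γ}
    (ha : len a < L) (hij : i ≠ j) (hadj : ¬ Γ.Adj i j) (h : gen Γ i * a = gen Γ j * b) :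
    ∃ c, a = gen Γ j * c ∧ b = gen Γ i * c := by
  cases H ha h
  · exact absurd rfl hij
  · exact ⟨_, rfl, rfl⟩
  · exact absurd ‹Γ.Adj i j› hadj

theorem ComplementBelow.of_braid {L : ℕ} (H : ComplementBelow Γ L) {i j : ι} {a b : ArtinMonoid Γ}
    (ha : len a < L) (hadj : Γ.Adj i j) (h : gen Γ i * a = gen Γ j * b) :
    ∃ c, a = gen Γ j * (gen Γ i * c) ∧ b = gen Γ i * (gen Γ j * c) := by
  cases H ha h
  · exact absurd hadj Γ.irrefl
  · exact absurd hadj ‹¬ Γ.Adj i j›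
  · exact ⟨_, rfl, rfl⟩

/-- The cube condition for a triple in which `k` is adjacent to `i` only among `i`, `j`. -/
theorem ComplementBelow.trans_braid_comm {L : ℕ}
    (H : ComplementBelow Γ L) {i j k : ι} {c e : ArtinMonoid Γ}
    (hik : Γ.Adj i k) (hkj : k ≠ j) (hkj' : ¬ Γ.Adj k j) (hij : i ≠ j)
    (hlen : len c + 1 < L) (h : gen Γ i * (gen Γ k * c) = gen Γ j * e) :
    Complement Γ i j (gen Γ k * (gen Γ i * c)) (gen Γ k * e) := by
  by_cases hadj : Γ.Adj i j
  · obtain ⟨f, hf, rfl⟩ := H.of_braid (by simpa using hlen) hadj h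
    obtain ⟨g, rfl, hg⟩ := H.of_comm (by omega) hkj hkj' hf
    obtain ⟨x, rfl, rfl⟩ := H.of_braid (i := i) (j := k)
      (by have := congrArg len hg; simp at this hlen; omega) hik hg
    have e1 : gen Γ k * (gen Γ i * (gen Γ j * (gen Γ i * (gen Γ k * x)))) =
        gen Γ j * (gen Γ i * (gen Γ k * (gen Γ i * (gen Γ j * x)))) := by
      rw [gen_braid hadj, gen_comm hkj hkj', ← gen_comm hkj hkj' x, gen_braid hik.symm]
    have e2 : gen Γ k * (gen Γ i * (gen Γ j * (gen Γ k * (gen Γ i * x)))) =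
        gen Γ i * (gen Γ j * (gen Γ k * (gen Γ i * (gen Γ j * x)))) := by
      rw [← gen_comm hkj hkj', gen_braid hik.symm, gen_braid hadj, gen_comm hkj hkj']
    rw [e1, e2]
    exact .braid _ _ _ hadj
  · obtain ⟨f, hf, rfl⟩ := H.of_comm (by simpa using hlen) hij hadj h
    obtain ⟨g, rfl, rfl⟩ := H.of_comm (by omega) hkj hkj' hf
    have e1 : gen Γ k * (gen Γ i * (gen Γ j * g)) = gen Γ j * (gen Γ k * (gen Γ i * g)) := by
      rw [gen_comm hij hadj, gen_comm hkj hkj']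
    rw [e1, gen_braid hik.symm]
    exact .comm _ _ _ hij hadj

theorem ComplementBelow.trans (htri : ∀ i j k, Γ.Adj i k → Γ.Adj j k → ¬ Γ.Adj i j)
    {L : ℕ} (H : ComplementBelow Γ L) {i j k : ι} {a b d : ArtinMonoid Γ} (hlen : len d ≤ L)
    (h1 : Complement Γ i k a d) (h2 : Complement Γ k j d b) : Complement Γ i j a b := by
  rcases h1 with _ | ⟨_, c, hik, hik'⟩ | ⟨_, c, hik⟩
  · exact h2
  · generalize hd : gen Γ i * c = d at h2 hlen
    rcases h2 with _ | ⟨_, e, hkj, hkj'⟩ | ⟨_, e, hkj⟩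
    · rw [← hd]; exact .comm _ _ _ hik hik'
    · rw [← hd] at hlen
      simp at hlen
      rcases eq_or_ne i j with rfl | hij
      · rw [H.cancel hlen hd]; exact .same _ _
      by_cases hadj : Γ.Adj i j
      · obtain ⟨f, rfl, rfl⟩ := H.of_braid hlen hadj hd
        rw [gen_comm hkj hkj', gen_comm hik.symm (fun h => hik' h.symm),
          gen_comm hik.symm (fun h => hik' h.symm), gen_comm hkj hkj']
        exact .braid _ _ _ hadj
      · obtain ⟨f, rfl, rfl⟩ := H.of_comm hlen hij hadj hd
        rw [gen_comm hkj hkj', gen_comm hik.symm (fun h => hik' h.symm)]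
        exact .comm _ _ _ hij hadj
    · rw [← hd] at hlen
      simp at hlen
      have hij : i ≠ j := by rintro rfl; exact hik' hkj.symm
      have hc : len c = len e + 1 := by simpa using congrArg len hd
      exact (H.trans_braid_comm hkj.symm hik.symm (fun h => hik' h.symm) hij.symm
        (by omega) hd.symm).symm
  · generalize hd : gen Γ i * (gen Γ k * c) = d at h2 hlen
    rcases h2 with _ | ⟨_, e, hkj, hkj'⟩ | ⟨_, e, hkj⟩
    · rw [← hd]; exact .braid _ _ _ hik
    · rw [← hd] at hlen
      simp at hlen
      have hij : i ≠ j := by rintro rfl; exact hkj' hik.symm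
      exact H.trans_braid_comm hik hkj hkj' hij (by omega) hd
    · rw [← hd] at hlen
      simp at hlen
      rcases eq_or_ne i j with rfl | hij
      · have := H.cancel (by simp; omega) hd
        rw [H.cancel (by omega) this]; exact .same _ _
      have hadj := htri i j k hik hkj.symm
      obtain ⟨f, hf, hf'⟩ := H.of_comm (by simp; omega) hij hadj hd
      have hl := congrArg len hd
      simp at hl
      obtain ⟨g, rfl, rfl⟩ := H.of_braid (by omega) hkj hf
      obtain ⟨x, rfl, hx⟩ := H.of_braid (by omega) hik.symm hf'
      have hx := H.cancel (by simp at hlen ⊢; omega) hx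
      obtain ⟨y, rfl, rfl⟩ := H.of_comm (by simp at hlen; omega) hij.symm (fun h => hadj h.symm) hx
      have e1 : gen Γ k * (gen Γ i * (gen Γ j * (gen Γ k * (gen Γ i * y)))) =
          gen Γ j * (gen Γ k * (gen Γ j * (gen Γ i * (gen Γ k * y)))) := by
        rw [gen_comm hij hadj, ← gen_braid hik.symm, gen_braid hkj,
          gen_comm hij.symm (fun h => hadj h.symm)]
      have e2 : gen Γ k * (gen Γ j * (gen Γ i * (gen Γ k * (gen Γ j * y)))) =
          gen Γ i * (gen Γ k * (gen Γ j * (gen Γ i * (gen Γ k * y)))) := by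
        rw [gen_comm hij.symm (fun h => hadj h.symm), ← gen_braid hkj, gen_braid hik.symm,
          gen_comm hij hadj]
      rw [e1, e2]
      exact .comm _ _ _ hij hadj

theorem complement_of_conGen (htri : ∀ i j k, Γ.Adj i k → Γ.Adj j k → ¬ Γ.Adj i j)
    {L : ℕ} (H : ComplementBelow Γ L) {w w' : FreeMonoid ι} (h : ConGen.Rel (ArtinRel Γ) w w')
    (hlen : len (PresentedMonoid.mk (ArtinRel Γ) w) ≤ L + 1) :
    (w = 1 ∧ w' = 1) ∨ ∃ i u j v, w = .of i * u ∧ w' = .of j * v ∧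
      Complement Γ i j (PresentedMonoid.mk _ u) (PresentedMonoid.mk _ v) := by
  have hmk : ∀ {w w' : FreeMonoid ι}, ConGen.Rel (ArtinRel Γ) w w' →
      PresentedMonoid.mk (ArtinRel Γ) w = PresentedMonoid.mk (ArtinRel Γ) w' :=
    fun h => PresentedMonoid.mk_eq_mk_iff.2 h
  have hcons : ∀ (i : ι) (u : FreeMonoid ι), PresentedMonoid.mk (ArtinRel Γ) (.of i * u) =
      gen Γ i * PresentedMonoid.mk (ArtinRel Γ) u := fun i u => map_mul _ _ _
  induction h with
  | of x y h =>
    right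
    rcases h with ⟨i, j, h⟩ | ⟨i, j, h, h'⟩
    · refine ⟨i, _, j, _, rfl, rfl, ?_⟩
      simpa [gen, PresentedMonoid.of] using Complement.braid i j (1 : ArtinMonoid Γ) h
    · refine ⟨i, _, j, _, rfl, rfl, ?_⟩
      simpa [gen, PresentedMonoid.of] using Complement.comm i j (1 : ArtinMonoid Γ) h h'
  | refl x =>
    induction x using FreeMonoid.casesOn with
    | one => exact .inl ⟨rfl, rfl⟩
    | of_mul i u => exact .inr ⟨i, u, i, u, rfl, rfl, .same _ _⟩
  | symm h ih =>
    rcases ih (by rwa [hmk h]) with ⟨h1, h2⟩ | ⟨i, u, j, v, h1, h2, h3⟩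
    · exact .inl ⟨h2, h1⟩
    · exact .inr ⟨j, v, i, u, h2, h1, h3.symm⟩
  | trans h h' ih ih' =>
    rcases ih hlen with ⟨h1, h2⟩ | ⟨i, u, k, v, h1, h2, h3⟩ <;>
    rcases ih' (by rwa [← hmk h]) with ⟨h4, h5⟩ | ⟨k', v', j, w, h4, h5, h6⟩
    · exact .inl ⟨h1, h5⟩
    · exact absurd (h2.symm.trans h4).symm (List.cons_ne_nil _ _)
    · exact absurd (h2.symm.trans h4) (List.cons_ne_nil _ _)
    · obtain ⟨rfl, rfl⟩ := List.cons.inj (h2.symm.trans h4)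
      refine .inr ⟨i, u, j, w, h1, h5, H.trans htri ?_ h3 h6⟩
      rw [hmk h, h2, hcons, len_gen_mul] at hlen
      omega
  | @mul p q x y h h' ih ih' =>
    rw [map_mul] at hlen
    have hl : ∀ a b : ArtinMonoid Γ, len (a * b) = len a + len b := fun a b => by simp [len]
    rw [hl] at hlen
    rcases ih (by omega) with ⟨rfl, rfl⟩ | ⟨i, u, j, v, rfl, rfl, h3⟩
    · simpa using ih' (by omega)
    · refine .inr ⟨i, u * x, j, v * y, mul_assoc _ _ _, mul_assoc _ _ _, ?_⟩
      rw [map_mul, map_mul, ← hmk h']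
      exact h3.mul_right _

/-- Garside's reduction lemma: a common multiple of two generators is a multiple of their least
common multiple. -/
theorem complement_of_gen_mul_eq (htri : ∀ i j k, Γ.Adj i k → Γ.Adj j k → ¬ Γ.Adj i j)
    {i j : ι} {a b : ArtinMonoid Γ} (h : gen Γ i * a = gen Γ j * b) : Complement Γ i j a b := by
  have key : ∀ L, ComplementBelow Γ L := by
    intro L
    induction L with
    | zero => intro i j a b h; simp at h
    | succ L ih =>
      intro i j a b hlen h
      obtain ⟨u, rfl⟩ := PresentedMonoid.surjective_mk a
      obtain ⟨v, rfl⟩ := PresentedMonoid.surjective_mk b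
      have h' : ConGen.Rel (ArtinRel Γ) (.of i * u) (.of j * v) :=
        PresentedMonoid.mk_eq_mk_iff.1 (by rw [map_mul, map_mul]; exact h)
      have hl : len (PresentedMonoid.mk (ArtinRel Γ) (.of i * u)) ≤ L + 1 := by
        rw [map_mul]
        exact (len_gen_mul i _).le.trans (by omega)
      rcases complement_of_conGen htri ih h' hl with ⟨h1, h2⟩ | ⟨i', u', j', v', h1, h2, h3⟩
      · exact absurd h1 (List.cons_ne_nil _ _)
      · obtain ⟨rfl, rfl⟩ := List.cons.inj h1
        obtain ⟨rfl, rfl⟩ := List.cons.inj h2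
        exact h3
  exact key _ (Nat.lt_succ_self _) h

theorem mul_left_cancel_of_triangleFree (htri : ∀ i j k, Γ.Adj i k → Γ.Adj j k → ¬ Γ.Adj i j)
    (c : ArtinMonoid Γ) {a b : ArtinMonoid Γ} (h : c * a = c * b) : a = b := by
  obtain ⟨w, rfl⟩ := PresentedMonoid.surjective_mk c
  induction w using FreeMonoid.recOn with
  | one => simpa using h
  | of_mul i w ih =>
    apply ih
    rw [map_mul, mul_assoc, mul_assoc] at h
    exact ComplementBelow.cancel (fun _ _ _ _ _ => complement_of_gen_mul_eq htri)
      (Nat.lt_succ_self _) h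

end ArtinMonoid

namespace HalfTwist

variable {N : Type*} [Monoid N]

/-- The product `s (k-1) * ⋯ * s 0`. -/
def coil (s : ℕ → N) : ℕ → N
  | 0 => 1
  | k + 1 => s k * coil s k

/-- The half-twist on the first `k` generators. -/
def halfTwist (s : ℕ → N) : ℕ → N
  | 0 => 1
  | k + 1 => halfTwist s k * coil s (k + 1)

theorem map_coil {N' : Type*} [Monoid N'] (f : N →* N') (s : ℕ → N) (k : ℕ) :
    f (coil s k) = coil (fun i => f (s i)) k := by
  induction k with
  | zero => simp [coil]
  | succ k ih => simp [coil, ih]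

theorem map_halfTwist {N' : Type*} [Monoid N'] (f : N →* N') (s : ℕ → N) (k : ℕ) :
    f (halfTwist s k) = halfTwist (fun i => f (s i)) k := by
  induction k with
  | zero => simp [halfTwist]
  | succ k ih => simp [halfTwist, ih, map_coil]

/-- The first `m` terms of a sequence satisfy the braid relations. -/
structure IsBraided (s : ℕ → N) (m : ℕ) : Prop where
  braid : ∀ i, i + 1 < m → s (i + 1) * (s i * s (i + 1)) = s i * (s (i + 1) * s i)
  comm : ∀ i j, i + 1 < j → j < m → s i * s j = s j * s i

variable {s : ℕ → N} {m : ℕ}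

theorem IsBraided.commute_coil (h : IsBraided s m) {k j : ℕ} (hk : k < j) (hj : j < m) :
    Commute (s j) (coil s k) := by
  induction k with
  | zero => exact Commute.one_right _
  | succ k ih => exact Commute.mul_right (h.comm k j hk hj).symm (ih (by omega))

theorem IsBraided.commute_halfTwist (h : IsBraided s m) {k j : ℕ} (hk : k < j) (hj : j < m) :
    Commute (s j) (halfTwist s k) := by
  induction k with
  | zero => exact Commute.one_right _
  | succ k ih => exact (ih (by omega)).mul_right (h.commute_coil hk hj)

theorem IsBraided.coil_mul (h : IsBraided s m) {k i : ℕ} (hi : i + 1 < k) (hk : k ≤ m) :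
    coil s k * s (i + 1) = s i * coil s k := by
  induction k with
  | zero => omega
  | succ k ih =>
    rcases Nat.lt_or_ge (i + 1) k with hik | hik
    · simp only [coil]
      rw [mul_assoc, ih hik (by omega), ← mul_assoc, ← h.comm i k hik (by omega), mul_assoc]
    · obtain rfl : k = i + 1 := by omega
      simp only [coil]
      rw [mul_assoc, mul_assoc, ← (h.commute_coil (Nat.lt_succ_self i) (by omega)).eq,
        ← mul_assoc (s i), ← mul_assoc, h.braid i (by omega)]
      simp only [mul_assoc]

theorem coil_succ_eq (s : ℕ → N) (k : ℕ) :
    coil s (k + 1) = coil (fun i => s (i + 1)) k * s 0 := by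
  induction k with
  | zero => simp [coil]
  | succ k ih => rw [coil, ih, coil, mul_assoc]

theorem IsBraided.coil_mul_coil_shift (h : IsBraided s m) {k l : ℕ} (hkl : k ≤ l) (hl : l < m) :
    coil s (l + 1) * coil (fun i => s (i + 1)) k = coil s k * coil s (l + 1) := by
  induction k with
  | zero => simp [coil]
  | succ k ih =>
    have hs : coil (fun i => s (i + 1)) (k + 1) = s (k + 1) * coil (fun i => s (i + 1)) k := rfl
    rw [hs, ← mul_assoc, h.coil_mul (by omega) hl, mul_assoc, ih (by omega), ← mul_assoc]
    rfl

theorem IsBraided.coil_mul_self (h : IsBraided s m) {k : ℕ} (hk : k < m) :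
    coil s (k + 1) * coil s (k + 1) = coil s k * (coil s (k + 1) * s 0) := by
  refine (congrArg (coil s (k + 1) * ·) (coil_succ_eq s k)).trans ?_
  rw [← mul_assoc, h.coil_mul_coil_shift le_rfl hk, mul_assoc]

theorem IsBraided.halfTwist_mul (h : IsBraided s m) {k i j : ℕ} (hij : i + j + 1 = k)
    (hk : k ≤ m) : halfTwist s k * s i = s j * halfTwist s k := by
  induction k generalizing i j with
  | zero => omega
  | succ k ih =>
    rcases i with _ | i
    · obtain rfl : j = k := by omega
      rcases j with _ | l
      · simp [halfTwist, coil]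
      · have hc := (h.commute_halfTwist (Nat.lt_succ_self l) hk).eq
        simp only [halfTwist]
        rw [mul_assoc, mul_assoc, mul_assoc, ← h.coil_mul_self (by omega),
          ← mul_assoc (s (l + 1)), hc]
        simp only [coil, mul_assoc]
    · simp only [halfTwist]
      rw [mul_assoc, h.coil_mul (by omega) hk, ← mul_assoc, ih (j := j) (by omega) (by omega),
        mul_assoc]

theorem IsBraided.exists_coil_mul_coil_eq (h : IsBraided s m) {k : ℕ} (hk : k < m) :
    ∃ z, coil s k * coil s (k + 1) = s k * z := by
  induction k with
  | zero => exact ⟨1, by simp [coil]⟩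
  | succ k ih =>
    obtain ⟨z, hz⟩ := ih (by omega)
    refine ⟨s k * (s (k + 1) * z), ?_⟩
    have hc := (h.commute_coil (Nat.lt_succ_self k) hk).eq
    calc coil s (k + 1) * coil s (k + 1 + 1)
        = s k * ((coil s k * s (k + 1)) * coil s (k + 1)) := by simp only [coil, mul_assoc]
      _ = s k * (s (k + 1) * (coil s k * coil s (k + 1))) := by rw [← hc, mul_assoc]
      _ = (s k * (s (k + 1) * s k)) * z := by rw [hz]; simp only [mul_assoc]
      _ = s (k + 1) * (s k * (s (k + 1) * z)) := by rw [← h.braid k hk]; simp only [mul_assoc]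

theorem IsBraided.dvd_halfTwist (h : IsBraided s m) {k i : ℕ} (hi : i < k) (hk : k ≤ m) :
    s i ∣ halfTwist s k := by
  induction k with
  | zero => omega
  | succ k ih =>
    rcases Nat.lt_or_ge i k with hik | hik
    · exact (ih hik (by omega)).mul_right _
    · obtain rfl : i = k := by omega
      rcases i with _ | l
      · exact ⟨1, by simp [halfTwist, coil]⟩
      · obtain ⟨z, hz⟩ := h.exists_coil_mul_coil_eq (k := l + 1) hk
        refine ⟨halfTwist s l * z, ?_⟩
        rw [← mul_assoc, (h.commute_halfTwist (Nat.lt_succ_self l) hk).eq, mul_assoc, ← hz]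
        simp only [halfTwist, mul_assoc]

theorem IsBraided.sq_halfTwist_mul (h : IsBraided s m) {i : ℕ} (hi : i < m) :
    halfTwist s m ^ 2 * s i = s i * halfTwist s m ^ 2 := by
  rw [sq, mul_assoc, h.halfTwist_mul (j := m - 1 - i) (by omega) le_rfl, ← mul_assoc,
    h.halfTwist_mul (j := i) (by omega) le_rfl, mul_assoc]

theorem filter_le_range (k m : ℕ) :
    (List.range m).filter (fun i => decide (i ≤ k)) = List.range (min m (k + 1)) := by
  induction m with
  | zero => simp
  | succ m ih =>
    rw [List.range_succ, List.filter_append, ih]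
    rcases Nat.lt_or_ge k m with hk | hk
    · simp [hk, show min (m + 1) (k + 1) = min m (k + 1) by omega]
    · simp [hk, show min m (k + 1) = m by omega,
        List.range_succ]

theorem prod_reverse_range (s : ℕ → N) (k : ℕ) :
    ((List.range k).reverse.map s).prod = coil s k := by
  induction k with
  | zero => rfl
  | succ k ih => simp [List.range_succ, coil, ← ih]

theorem prod_coil_range (s : ℕ → N) (k : ℕ) :
    ((List.range k).map fun l => coil s (l + 1)).prod = halfTwist s k := by
  induction k with
  | zero => rfl
  | succ k ih => simp [List.range_succ, halfTwist, ← ih]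

theorem prod_finRange_eq_halfTwist (s : ℕ → N) (m : ℕ) (g : Fin m → N) (hg : ∀ i, g i = s i) :
    ((List.finRange m).map fun k =>
      (((List.finRange m).filter fun i => decide (i ≤ k)).reverse.map g).prod).prod =
      halfTwist s m := by
  obtain rfl : g = fun i : Fin m => s i := funext hg
  rw [← prod_coil_range]
  have hrange : List.range m = (List.finRange m).map Fin.val := by simp
  rw [hrange, List.map_map]
  congr 1
  refine List.map_congr_left fun k _ => ?_
  have hk : List.range (k + 1) = (List.range m).filter fun i => decide (i ≤ (k : ℕ)) := by
    rw [filter_le_range, Nat.min_eq_right k.2]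
  rw [Function.comp, ← prod_reverse_range, hk, hrange, List.filter_map, ← List.map_reverse,
    List.map_map]
  rfl

end HalfTwist

/-- The extension of a finite sequence by `1`. -/
def extendGen {N : Type*} [Monoid N] {m : ℕ} (g : Fin m → N) (i : ℕ) : N :=
  if h : i < m then g ⟨i, h⟩ else 1

theorem extendGen_val {N : Type*} [Monoid N] {m : ℕ} (g : Fin m → N) (i : Fin m) :
    extendGen g i = g i := by
  simp [extendGen]

open HalfTwist in
theorem isBraided_extendGen {N : Type*} [Monoid N] {m : ℕ} {g : Fin m → N}
    (hb : ∀ i j : Fin m, (i : ℕ) + 1 = j → g i * (g j * g i) = g j * (g i * g j))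
    (hc : ∀ i j : Fin m, (i : ℕ) + 1 < j → g i * g j = g j * g i) : IsBraided (extendGen g) m where
  braid i hi := by
    have := hb ⟨i, by omega⟩ ⟨i + 1, hi⟩ rfl
    simpa [extendGen, hi, show i < m by omega] using this.symm
  comm i j hij hj := by
    have := hc ⟨i, by omega⟩ ⟨j, hj⟩ hij
    simpa [extendGen, hj, show i < m by omega] using this

theorem map_extendGen {N N' : Type*} [Monoid N] [Monoid N'] (f : N →* N') {m : ℕ} (g : Fin m → N)
    (i : ℕ) : f (extendGen g i) = extendGen (fun j => f (g j)) i := by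
  unfold extendGen
  split <;> simp

/-- The braid monoid presented by the braid relations. -/
abbrev BraidMonoid (n : ℕ) := ArtinMonoid (SimpleGraph.pathGraph (n - 1))

theorem pathGraph_triangleFree {m : ℕ} (i j k : Fin m) (hik : (SimpleGraph.pathGraph m).Adj i k)
    (hjk : (SimpleGraph.pathGraph m).Adj j k) : ¬ (SimpleGraph.pathGraph m).Adj i j := by
  rw [SimpleGraph.pathGraph_adj] at *
  omega

theorem braidGen_braid {n : ℕ} {i j : Fin (n - 1)} (h : (i : ℕ) + 1 = j) :
    braidGen n i * (braidGen n j * braidGen n i) = braidGen n j * (braidGen n i * braidGen n j) := by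
  have := PresentedGroup.mk_eq_one_iff.2
    (Subgroup.subset_normalClosure (show _ ∈ braidRels n from .inl ⟨i, j, h, rfl⟩))
  rw [map_mul, map_inv, mul_inv_eq_one] at this
  simpa only [map_mul, mul_assoc, braidGen, PresentedGroup.of] using this

theorem braidGen_comm {n : ℕ} {i j : Fin (n - 1)} (h : (i : ℕ) + 1 < j) :
    braidGen n i * braidGen n j = braidGen n j * braidGen n i := by
  have := PresentedGroup.mk_eq_one_iff.2
    (Subgroup.subset_normalClosure (show _ ∈ braidRels n from .inr ⟨i, j, h, rfl⟩))
  rw [map_mul, map_inv, mul_inv_eq_one] at this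
  simpa only [map_mul, braidGen, PresentedGroup.of] using this

theorem lift_artinRel_pathGraph {N : Type*} [Monoid N] {m : ℕ} {g : Fin m → N}
    (hb : ∀ i j : Fin m, (i : ℕ) + 1 = j → g i * (g j * g i) = g j * (g i * g j))
    (hc : ∀ i j : Fin m, (i : ℕ) + 1 < j → g i * g j = g j * g i) (a b : FreeMonoid (Fin m))
    (h : ArtinRel (SimpleGraph.pathGraph m) a b) : FreeMonoid.lift g a = FreeMonoid.lift g b := by
  rcases h with ⟨i, j, h⟩ | ⟨i, j, h, h'⟩
  · rcases SimpleGraph.pathGraph_adj.1 h with h | h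
    · simpa using hb i j h
    · simpa using (hb j i h).symm
  · rw [SimpleGraph.pathGraph_adj] at h'
    have : (i : ℕ) ≠ j := fun e => h (Fin.ext e)
    rcases Nat.lt_or_ge i j with hij | hij
    · simpa using hc i j (by omega)
    · simpa using (hc j i (by omega)).symm

/-- The canonical map from the braid monoid to the braid group. -/
def toBraid (n : ℕ) : BraidMonoid n →* BraidGroup n :=
  PresentedMonoid.lift (braidGen n)
    (lift_artinRel_pathGraph (fun _ _ => braidGen_braid) fun _ _ => braidGen_comm)

@[simp] theorem toBraid_gen (n : ℕ) (i : Fin (n - 1)) :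
    toBraid n (ArtinMonoid.gen _ i) = braidGen n i := rfl

theorem braidMonoid_gen_braid {n : ℕ} (i j : Fin (n - 1)) (h : (i : ℕ) + 1 = j) :
    ArtinMonoid.gen (SimpleGraph.pathGraph (n - 1)) i * (ArtinMonoid.gen _ j * ArtinMonoid.gen _ i) =
      ArtinMonoid.gen _ j * (ArtinMonoid.gen _ i * ArtinMonoid.gen _ j) := by
  simpa using ArtinMonoid.gen_braid (SimpleGraph.pathGraph_adj.2 (.inl h)) 1

theorem braidMonoid_gen_comm {n : ℕ} (i j : Fin (n - 1)) (h : (i : ℕ) + 1 < j) :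
    ArtinMonoid.gen (SimpleGraph.pathGraph (n - 1)) i * ArtinMonoid.gen _ j =
      ArtinMonoid.gen _ j * ArtinMonoid.gen _ i := by
  simpa using ArtinMonoid.gen_comm (Γ := SimpleGraph.pathGraph (n - 1)) (i := i) (j := j)
    (by rintro rfl; omega) (by rw [SimpleGraph.pathGraph_adj]; omega) 1

theorem PresentedMonoid.commute_of_forall_of {α : Type*} {rels : FreeMonoid α → FreeMonoid α → Prop}
    {c : PresentedMonoid rels} (h : ∀ i, Commute c (.of rels i)) (x : PresentedMonoid rels) :
    Commute c x := by
  have hx : x ∈ Submonoid.closure (Set.range (PresentedMonoid.of rels)) := by simp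
  induction hx using Submonoid.closure_induction with
  | mem x hx => obtain ⟨i, rfl⟩ := hx; exact h i
  | one => exact Commute.one_right _
  | mul x y _ _ hx hy => exact hx.mul_right hy

/-- The Ore condition for the powers of a central element. -/
@[reducible] def oreSetPowers {N : Type*} [Monoid N] (c : N) (hc : ∀ x, Commute c x) :
    OreLocalization.OreSet (Submonoid.powers c) where
  ore_right_cancel a b s h := by
    obtain ⟨_, k, rfl⟩ := s
    exact ⟨⟨_, k, rfl⟩, by rw [((hc a).pow_left k).eq, ((hc b).pow_left k).eq]; exact h⟩
  oreNum r _ := r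
  oreDenom _ s := s
  ore_eq r s := by
    obtain ⟨_, k, rfl⟩ := s
    exact ((hc r).pow_left k).eq

open HalfTwist in
theorem toBraid_injective (n : ℕ) : Function.Injective (toBraid n) := by
  set Γ := SimpleGraph.pathGraph (n - 1)
  have hbr : IsBraided (extendGen (ArtinMonoid.gen Γ)) (n - 1) :=
    isBraided_extendGen braidMonoid_gen_braid braidMonoid_gen_comm
  set c := halfTwist (extendGen (ArtinMonoid.gen Γ)) (n - 1) ^ 2
  have hc : ∀ x, Commute c x := PresentedMonoid.commute_of_forall_of fun i => by
    have := hbr.sq_halfTwist_mul i.2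
    rwa [extendGen_val] at this
  have hcancel : ∀ x a b : BraidMonoid n, x * a = x * b → a = b := fun x _ _ =>
    ArtinMonoid.mul_left_cancel_of_triangleFree pathGraph_triangleFree x
  let _ := oreSetPowers c hc
  let num : BraidMonoid n →* OreLocalization (Submonoid.powers c) (BraidMonoid n) :=
    OreLocalization.numeratorHom
  have hunit : ∀ i, IsUnit (num (ArtinMonoid.gen Γ i)) := by
    intro i
    obtain ⟨y, hy⟩ : ArtinMonoid.gen Γ i ∣ c := by
      have := (hbr.dvd_halfTwist i.2 le_rfl).mul_right
        (halfTwist (extendGen (ArtinMonoid.gen Γ)) (n - 1))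
      rwa [extendGen_val, ← sq] at this
    have hy' : y * ArtinMonoid.gen Γ i = c := by
      apply hcancel (ArtinMonoid.gen Γ i)
      rw [← mul_assoc, ← hy, (hc _).eq]
    have hcu : IsUnit (num c) := OreLocalization.numerator_isUnit ⟨c, Submonoid.mem_powers c⟩
    obtain ⟨u, hu⟩ := hcu
    rw [isUnit_iff_exists_and_exists]
    refine ⟨⟨num y * ↑u⁻¹, ?_⟩, ⟨↑u⁻¹ * num y, ?_⟩⟩
    · rw [← mul_assoc, ← map_mul, ← hy, ← hu, Units.mul_inv]
    · rw [mul_assoc, ← map_mul, hy', ← hu, Units.inv_mul]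
  choose u hu using hunit
  have hrel : ∀ r ∈ braidRels n, FreeGroup.lift u r = 1 := by
    rintro r (⟨i, j, h, rfl⟩ | ⟨i, j, h, rfl⟩)
    · rw [map_mul, map_inv, mul_inv_eq_one]
      ext
      simp only [mul_assoc, map_mul, FreeGroup.lift_apply_of, Units.val_mul, hu]
      rw [← map_mul, ← map_mul, ← map_mul, ← map_mul, braidMonoid_gen_braid i j h]
    · rw [map_mul, map_inv, mul_inv_eq_one]
      ext
      simp only [map_mul, FreeGroup.lift_apply_of, Units.val_mul, hu]
      rw [← map_mul, ← map_mul, braidMonoid_gen_comm i j h]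
  have hcomp : ((Units.coeHom _).comp (PresentedGroup.toGroup hrel)).comp (toBraid n) = num := by
    apply PresentedMonoid.ext
    intro i
    change Units.coeHom _ (PresentedGroup.toGroup hrel (PresentedGroup.of i)) = _
    rw [PresentedGroup.toGroup.of]
    exact hu i
  intro a b hab
  have hnum : num a = num b := by
    rw [← hcomp]
    simp only [MonoidHom.comp_apply, hab]
  obtain ⟨s, v, h1, h2⟩ := OreLocalization.oreDiv_eq_iff.1 hnum
  simp only [Submonoid.smul_def, smul_eq_mul, OneMemClass.coe_one, mul_one] at h1 h2
  rw [← h2] at h1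
  exact (hcancel _ _ _ h1).symm

section Garside

variable {n : ℕ}

theorem isBraided_braidGen (n : ℕ) : HalfTwist.IsBraided (extendGen (braidGen n)) (n - 1) :=
  isBraided_extendGen (fun _ _ => braidGen_braid) fun _ _ => braidGen_comm

theorem braidDelta_eq_halfTwist (n : ℕ) :
    braidDelta n = HalfTwist.halfTwist (extendGen (braidGen n)) (n - 1) :=
  HalfTwist.prod_finRange_eq_halfTwist _ _ _ fun i => (extendGen_val _ i).symm

theorem braidDelta_mul_braidGen (i : Fin (n - 1)) :
    braidDelta n * braidGen n i = braidGen n i.rev * braidDelta n := by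
  have := (isBraided_braidGen n).halfTwist_mul (i := i) (j := i.rev)
    (by rw [Fin.val_rev]; omega) le_rfl
  rwa [extendGen_val, extendGen_val, ← braidDelta_eq_halfTwist] at this

theorem commute_sq_braidDelta (x : BraidGroup n) : Commute (braidDelta n ^ 2) x := by
  have hgen : ∀ i, Commute (braidDelta n ^ 2) (braidGen n i) := fun i => by
    have := (isBraided_braidGen n).sq_halfTwist_mul i.2
    rwa [extendGen_val, ← braidDelta_eq_halfTwist] at this
  induction x using PresentedGroup.induction_on with | _ w
  induction w using FreeGroup.induction_on with
  | C1 => exact Commute.one_right _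
  | of i => exact hgen i
  | inv_of i _ => exact (hgen i).inv_right
  | mul x y hx hy => rw [map_mul]; exact hx.mul_right hy

theorem braidGen_mem (i : Fin (n - 1)) : braidGen n i ∈ PosBraid n :=
  Submonoid.subset_closure ⟨i, rfl⟩

theorem mem_posBraid_iff {b : BraidGroup n} : b ∈ PosBraid n ↔ ∃ a, toBraid n a = b := by
  constructor
  · intro hb
    induction hb using Submonoid.closure_induction with
    | mem x hx => obtain ⟨i, rfl⟩ := hx; exact ⟨_, toBraid_gen n i⟩
    | one => exact ⟨1, map_one _⟩
    | mul x y _ _ hx hy =>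
      obtain ⟨a, rfl⟩ := hx
      obtain ⟨b, rfl⟩ := hy
      exact ⟨a * b, map_mul _ _ _⟩
  · rintro ⟨a, rfl⟩
    have ha : a ∈ Submonoid.closure (Set.range (PresentedMonoid.of
      (ArtinRel (SimpleGraph.pathGraph (n - 1))))) := by simp
    induction ha using Submonoid.closure_induction with
    | mem x hx => obtain ⟨i, rfl⟩ := hx; exact braidGen_mem i
    | one => rw [map_one]; exact one_mem _
    | mul x y _ _ hx hy => rw [map_mul]; exact mul_mem hx hy

theorem posBraid_eq_one_or {b : BraidGroup n} (hb : b ∈ PosBraid n) :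
    b = 1 ∨ ∃ i, PrefixLE n (braidGen n i) b := by
  induction hb using Submonoid.closure_induction_left with
  | one => exact .inl rfl
  | mul_left x hx y hy _ =>
    obtain ⟨i, rfl⟩ := hx
    exact .inr ⟨i, y, hy, rfl⟩

/-- The exponent sum of a braid. -/
def expSumHom (n : ℕ) : BraidGroup n →* Multiplicative ℤ :=
  PresentedGroup.toGroup (f := fun _ => Multiplicative.ofAdd 1) (by
    rintro r (⟨i, j, h, rfl⟩ | ⟨i, j, h, rfl⟩) <;> simp)

/-- The exponent sum of a braid. -/
def expSum (b : BraidGroup n) : ℤ := (expSumHom n b).toAdd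

theorem expSum_mul (a b : BraidGroup n) : expSum (a * b) = expSum a + expSum b := by
  simp [expSum]

theorem expSum_braidGen (i : Fin (n - 1)) : expSum (braidGen n i) = 1 := by
  simp [expSum, expSumHom, braidGen]

theorem expSum_nonneg {b : BraidGroup n} (hb : b ∈ PosBraid n) : 0 ≤ expSum b := by
  induction hb using Submonoid.closure_induction with
  | mem x hx => obtain ⟨i, rfl⟩ := hx; simp [expSum_braidGen]
  | one => simp [expSum]
  | mul x y _ _ hx hy => rw [expSum_mul]; omega

namespace PrefixLE

variable {a b c u v : BraidGroup n}

theorem refl (a : BraidGroup n) : PrefixLE n a a := ⟨1, one_mem _, mul_one _⟩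

theorem trans (h : PrefixLE n a b) (h' : PrefixLE n b c) : PrefixLE n a c := by
  obtain ⟨x, hx, rfl⟩ := h
  obtain ⟨y, hy, rfl⟩ := h'
  exact ⟨x * y, mul_mem hx hy, (mul_assoc _ _ _).symm⟩

theorem mul_left (c : BraidGroup n) (h : PrefixLE n a b) : PrefixLE n (c * a) (c * b) := by
  obtain ⟨x, hx, rfl⟩ := h
  exact ⟨x, hx, mul_assoc _ _ _⟩

theorem of_mul_left (h : PrefixLE n (c * a) (c * b)) : PrefixLE n a b := by
  simpa using h.mul_left c⁻¹

theorem one_left (h : a ∈ PosBraid n) : PrefixLE n 1 a := ⟨a, h, one_mul _⟩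

theorem expSum_le (h : PrefixLE n a b) : expSum a ≤ expSum b := by
  obtain ⟨x, hx, rfl⟩ := h
  rw [expSum_mul]
  linarith [expSum_nonneg hx]

theorem eq_or_braidGen (h : PrefixLE n a b) :
    a = b ∨ ∃ i, PrefixLE n (a * braidGen n i) b := by
  obtain ⟨x, hx, rfl⟩ := h
  rcases posBraid_eq_one_or hx with rfl | ⟨i, hi⟩
  · exact .inl (mul_one _).symm
  · exact .inr ⟨i, hi.mul_left a⟩

theorem eq_of_expSum_le (h : PrefixLE n a b) (hle : expSum b ≤ expSum a) : a = b := by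
  rcases h.eq_or_braidGen with rfl | ⟨i, hi⟩
  · rfl
  · have := hi.expSum_le
    rw [expSum_mul, expSum_braidGen] at this
    omega

end PrefixLE

theorem mem_posBraid_of_one_le {a : BraidGroup n} (h : PrefixLE n 1 a) : a ∈ PosBraid n := by
  obtain ⟨x, hx, rfl⟩ := h
  rwa [one_mul]

theorem braidDelta_mem (n : ℕ) : braidDelta n ∈ PosBraid n := by
  refine Submonoid.list_prod_mem _ fun x hx => ?_
  obtain ⟨k, _, rfl⟩ := List.mem_map.1 hx
  refine Submonoid.list_prod_mem _ fun y hy => ?_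
  obtain ⟨i, _, rfl⟩ := List.mem_map.1 hy
  exact braidGen_mem i

theorem braidGen_le_braidDelta (i : Fin (n - 1)) : PrefixLE n (braidGen n i) (braidDelta n) := by
  have key : ∀ a : BraidMonoid n, toBraid n a ∈ PosBraid n := fun a => mem_posBraid_iff.2 ⟨a, rfl⟩
  have hM : HalfTwist.IsBraided
      (extendGen (ArtinMonoid.gen (SimpleGraph.pathGraph (n - 1)))) (n - 1) :=
    isBraided_extendGen braidMonoid_gen_braid braidMonoid_gen_comm
  obtain ⟨y, hy⟩ := hM.dvd_halfTwist i.2 le_rfl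
  refine ⟨toBraid n y, key y, ?_⟩
  rw [extendGen_val] at hy
  rw [← toBraid_gen, ← map_mul, ← hy, braidDelta_eq_halfTwist, HalfTwist.map_halfTwist]
  simp only [map_extendGen, toBraid_gen]

/-- Any two generators have a least common right multiple. -/
theorem exists_lcm_braidGen (i j : Fin (n - 1)) : ∃ m, PrefixLE n (braidGen n i) m ∧
    PrefixLE n (braidGen n j) m ∧
    ∀ u, PrefixLE n (braidGen n i) u → PrefixLE n (braidGen n j) u → PrefixLE n m u := by
  have key : ∀ u, PrefixLE n (braidGen n i) u → PrefixLE n (braidGen n j) u → ∃ a b,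
      u = braidGen n i * toBraid n a ∧
      ArtinMonoid.Complement (SimpleGraph.pathGraph (n - 1)) i j a b := by
    rintro _ ⟨x, hx, rfl⟩ ⟨y, hy, hxy⟩
    obtain ⟨a, rfl⟩ := mem_posBraid_iff.1 hx
    obtain ⟨b, rfl⟩ := mem_posBraid_iff.1 hy
    refine ⟨a, b, rfl, ArtinMonoid.complement_of_gen_mul_eq pathGraph_triangleFree ?_⟩
    apply toBraid_injective
    rw [map_mul, map_mul, toBraid_gen, toBraid_gen, hxy]
  have hpos : ∀ a : BraidMonoid n, toBraid n a ∈ PosBraid n := fun a => mem_posBraid_iff.2 ⟨a, rfl⟩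
  rcases eq_or_ne i j with rfl | hij
  · exact ⟨_, .refl _, .refl _, fun u hu _ => hu⟩
  by_cases hadj : (SimpleGraph.pathGraph (n - 1)).Adj i j
  · refine ⟨braidGen n i * (braidGen n j * braidGen n i),
      ⟨_, mul_mem (braidGen_mem j) (braidGen_mem i), rfl⟩,
      ⟨braidGen n i * braidGen n j, mul_mem (braidGen_mem i) (braidGen_mem j), ?_⟩,
      fun u hu hu' => ?_⟩
    · rcases SimpleGraph.pathGraph_adj.1 hadj with h | h
      · exact (braidGen_braid h).symm
      · exact braidGen_braid h
    · obtain ⟨a, b, rfl, hc⟩ := key u hu hu'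
      cases hc with
      | same => exact absurd rfl hij
      | comm _ c _ h => exact absurd hadj h
      | braid _ c _ => exact ⟨toBraid n c, hpos c, by simp only [map_mul, toBraid_gen, mul_assoc]⟩
  · have hcomm : braidGen n j * braidGen n i = braidGen n i * braidGen n j := by
      simpa using congrArg (toBraid n) (ArtinMonoid.gen_comm hij hadj 1).symm
    refine ⟨braidGen n i * braidGen n j, ⟨_, braidGen_mem j, rfl⟩, ⟨_, braidGen_mem i, hcomm⟩,
      fun u hu hu' => ?_⟩
    obtain ⟨a, b, rfl, hc⟩ := key u hu hu'
    cases hc with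
    | same => exact absurd rfl hij
    | comm _ c _ h => exact ⟨toBraid n c, hpos c, by simp only [map_mul, toBraid_gen, mul_assoc]⟩
    | braid _ c h => exact absurd h hadj

theorem sq_braidDelta_mem (n : ℕ) (k : ℕ) : (braidDelta n ^ 2) ^ k ∈ PosBraid n :=
  pow_mem (pow_mem (braidDelta_mem n) 2) k

/-- Every braid becomes positive after multiplication by a power of the central element `Δ ^ 2`. -/
theorem exists_sq_braidDelta_mul_mem (a : BraidGroup n) :
    ∃ k : ℕ, (braidDelta n ^ 2) ^ k * a ∈ PosBraid n := by
  induction a using PresentedGroup.induction_on with | _ w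
  induction w using FreeGroup.induction_on with
  | C1 => exact ⟨0, by simp⟩
  | of i => exact ⟨0, by rw [pow_zero, one_mul]; exact braidGen_mem i⟩
  | inv_of i _ =>
    obtain ⟨y, hy, h⟩ := braidGen_le_braidDelta i
    refine ⟨1, ?_⟩
    rw [pow_one, map_inv, ((commute_sq_braidDelta _).eq : braidDelta n ^ 2 * _ = _)]
    have : (PresentedGroup.mk (braidRels n) (FreeGroup.of i))⁻¹ * braidDelta n ^ 2 =
        y * braidDelta n := by
      rw [sq, inv_mul_eq_iff_eq_mul, ← mul_assoc]
      exact congrArg (· * braidDelta n) h.symm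
    rw [this]
    exact mul_mem hy (braidDelta_mem n)
  | mul x y hx hy =>
    obtain ⟨k, hk⟩ := hx
    obtain ⟨l, hl⟩ := hy
    refine ⟨k + l, ?_⟩
    have := mul_mem hk hl
    rw [map_mul, pow_add, mul_assoc, ← mul_assoc (_ ^ l),
      ((commute_sq_braidDelta _).pow_left l).eq]
    simpa only [mul_assoc] using this

theorem exists_common_lower_bound (a b : BraidGroup n) : ∃ g, PrefixLE n g a ∧ PrefixLE n g b := by
  obtain ⟨k, hk⟩ := exists_sq_braidDelta_mul_mem a
  obtain ⟨l, hl⟩ := exists_sq_braidDelta_mul_mem b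
  have h : ∀ (p : ℕ) (x : BraidGroup n), (braidDelta n ^ 2) ^ p * x ∈ PosBraid n →
      PrefixLE n ((braidDelta n ^ 2) ^ p)⁻¹ x := fun p x hx => ⟨_, hx, by simp⟩
  refine ⟨((braidDelta n ^ 2) ^ (k + l))⁻¹, h _ _ ?_, h _ _ ?_⟩
  · rw [add_comm, pow_add, mul_assoc]
    exact mul_mem (sq_braidDelta_mem n l) hk
  · rw [pow_add, mul_assoc]
    exact mul_mem (sq_braidDelta_mem n k) hl

theorem exists_common_extension {u v : BraidGroup n} (N : ℕ) {g c d : BraidGroup n}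
    (hN : expSum u - expSum g < N) (hgc : PrefixLE n g c) (hgd : PrefixLE n g d)
    (hcu : PrefixLE n c u) (hcv : PrefixLE n c v) (hdu : PrefixLE n d u) (hdv : PrefixLE n d v) :
    ∃ e, PrefixLE n c e ∧ PrefixLE n d e ∧ PrefixLE n e u ∧ PrefixLE n e v := by
  induction N generalizing g c d with
  | zero =>
    have := (hgc.trans hcu).expSum_le
    simp at hN
    omega
  | succ N ih =>
    rcases hgc.eq_or_braidGen with rfl | ⟨i, hi⟩
    · exact ⟨d, hgd, .refl _, hdu, hdv⟩
    rcases hgd.eq_or_braidGen with rfl | ⟨j, hj⟩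
    · exact ⟨c, .refl _, hgc, hcu, hcv⟩
    obtain ⟨m, him, hjm, hm⟩ := exists_lcm_braidGen i j
    have hstep : ∀ k, expSum u - expSum (g * braidGen n k) < N := by
      intro k
      rw [expSum_mul, expSum_braidGen]
      push_cast at hN
      omega
    have hlcm : ∀ w, PrefixLE n c w → PrefixLE n d w → PrefixLE n (g * m) w := by
      intro w hcw hdw
      have := hm (g⁻¹ * w) (PrefixLE.of_mul_left (c := g) (by simpa using hi.trans hcw))
        (PrefixLE.of_mul_left (c := g) (by simpa using hj.trans hdw))
      simpa using this.mul_left g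
    obtain ⟨e, hce, hme, heu, hev⟩ := ih (hstep i) hi (him.mul_left g) hcu hcv
      (hlcm u hcu hdu) (hlcm v hcv hdv)
    obtain ⟨f, hef, hdf, hfu, hfv⟩ := ih (hstep j) ((hjm.mul_left g).trans hme) hj heu hev hdu hdv
    exact ⟨f, hce.trans hef, hdf, hfu, hfv⟩

/-- Any two braids have a greatest lower bound for the prefix order. -/
theorem exists_meet (u v : BraidGroup n) : ∃ d, PrefixLE n d u ∧ PrefixLE n d v ∧
    ∀ c, PrefixLE n c u → PrefixLE n c v → PrefixLE n c d := by
  obtain ⟨g, hgu, hgv⟩ := exists_common_lower_bound u v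
  obtain ⟨L, ⟨d, hdu, hdv, rfl⟩, hmax⟩ := Int.exists_greatest_of_bdd
    (P := fun z => ∃ d : BraidGroup n, PrefixLE n d u ∧ PrefixLE n d v ∧ expSum d = z)
    ⟨expSum u, by rintro _ ⟨d, hd, _, rfl⟩; exact hd.expSum_le⟩ ⟨_, g, hgu, hgv, rfl⟩
  refine ⟨d, hdu, hdv, fun c hcu hcv => ?_⟩
  obtain ⟨b, hbc, hbd⟩ := exists_common_lower_bound c d
  obtain ⟨e, hce, hde, heu, hev⟩ := exists_common_extension
    ((expSum u - expSum b).toNat + 1) (by push_cast; omega) hbc hbd hcu hcv hdu hdv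
  rwa [hde.eq_of_expSum_le (hmax _ ⟨e, heu, hev, rfl⟩)]

theorem conj_braidDelta_mem {p : BraidGroup n} (hp : p ∈ PosBraid n) :
    braidDelta n * p * (braidDelta n)⁻¹ ∈ PosBraid n ∧
      (braidDelta n)⁻¹ * p * braidDelta n ∈ PosBraid n := by
  induction hp using Submonoid.closure_induction with
  | mem x hx =>
    obtain ⟨i, rfl⟩ := hx
    constructor
    · rw [braidDelta_mul_braidGen, mul_inv_cancel_right]
      exact braidGen_mem _
    · have := braidDelta_mul_braidGen i.rev
      rw [Fin.rev_rev] at this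
      rw [mul_assoc, ← this, inv_mul_cancel_left]
      exact braidGen_mem _
  | one => simp
  | mul x y _ _ hx hy =>
    refine ⟨?_, ?_⟩
    · simpa [mul_assoc] using mul_mem hx.1 hy.1
    · simpa [mul_assoc] using mul_mem hx.2 hy.2

theorem conj_zpow_braidDelta_mem {p : BraidGroup n} (hp : p ∈ PosBraid n) (j : ℤ) :
    (braidDelta n ^ j)⁻¹ * p * braidDelta n ^ j ∈ PosBraid n := by
  induction j with
  | zero => simpa
  | succ k ih =>
    rw [zpow_add_one]
    simpa [mul_assoc] using (conj_braidDelta_mem ih).2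
  | pred k ih =>
    rw [zpow_sub_one]
    simpa [mul_assoc] using (conj_braidDelta_mem ih).1

theorem PrefixLE.mul_zpow_braidDelta {a b : BraidGroup n} (h : PrefixLE n a b) (j : ℤ) :
    PrefixLE n (a * braidDelta n ^ j) (b * braidDelta n ^ j) := by
  obtain ⟨x, hx, rfl⟩ := h
  exact ⟨_, conj_zpow_braidDelta_mem hx j, by simp [mul_assoc]⟩

theorem infGE_iff {j : ℤ} {a : BraidGroup n} : InfGE n j a ↔ PrefixLE n (braidDelta n ^ j) a :=
  ⟨fun ⟨p, hp, h⟩ => ⟨p, hp, h.symm⟩, fun ⟨p, hp, h⟩ => ⟨p, hp, h.symm⟩⟩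

theorem InfGE.mono {j k : ℤ} {a : BraidGroup n} (h : InfGE n k a) (hjk : j ≤ k) :
    InfGE n j a := by
  obtain ⟨l, rfl⟩ := Int.le.dest hjk
  rw [infGE_iff] at *
  refine PrefixLE.trans ⟨braidDelta n ^ l, pow_mem (braidDelta_mem n) l, ?_⟩ h
  rw [zpow_add, zpow_natCast]

theorem infGE_conj_iff {j : ℤ} {a s : BraidGroup n} :
    InfGE n j (s⁻¹ * a * s) ↔ PrefixLE n (s * braidDelta n ^ j) (a * s) := by
  rw [infGE_iff]
  constructor
  · intro h
    simpa [mul_assoc] using h.mul_left s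
  · intro h
    simpa [mul_assoc] using h.mul_left s⁻¹

variable {r : ℕ} {J : Fin r → ℤ} {δ : Fin r → BraidGroup n}

theorem propP_braidDelta (h : CJ n r J δ) : PropP n r J δ (braidDelta n) := by
  intro i
  obtain ⟨p, hp, hi⟩ := h i
  refine ⟨_, (conj_braidDelta_mem hp).2, ?_⟩
  have : braidDelta n ^ J i * (braidDelta n)⁻¹ = (braidDelta n)⁻¹ * braidDelta n ^ J i := by
    rw [← zpow_neg_one, ← zpow_add, ← zpow_add, add_comm]
  rw [hi, ← mul_assoc, ← mul_assoc, ← mul_assoc, this]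

theorem PropP.meet {x y d : BraidGroup n} (hx : PropP n r J δ x) (hy : PropP n r J δ y)
    (hdx : PrefixLE n d x) (hdy : PrefixLE n d y)
    (hd : ∀ c, PrefixLE n c x → PrefixLE n c y → PrefixLE n c d) : PropP n r J δ d := by
  intro i
  rw [infGE_conj_iff]
  have key : ∀ z, PropP n r J δ z → PrefixLE n d z →
      PrefixLE n ((δ i)⁻¹ * (d * braidDelta n ^ J i)) z := by
    intro z hz hdz
    have := (hdz.mul_zpow_braidDelta (J i)).trans (infGE_conj_iff.1 (hz i))
    simpa using this.mul_left (δ i)⁻¹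
  simpa using (hd _ (key x hx hdx) (key y hy hdy)).mul_left (δ i)

/-- A nontrivial positive braid conjugating a tuple of `C_J` into `C_J` has a minimal simple
prefix. -/
theorem exists_minSimple_le (hδ : CJ n r J δ) {x : BraidGroup n} (hx : x ∈ PosBraid n)
    (hx1 : x ≠ 1) (hP : PropP n r J δ x) : ∃ t, MinSimple n r J δ t ∧ PrefixLE n t x := by
  obtain ⟨d, hdx, hdD, hd⟩ := exists_meet x (braidDelta n)
  have hd1 : d ≠ 1 := by
    rintro rfl
    obtain ⟨i, hi⟩ := (posBraid_eq_one_or hx).resolve_left hx1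
    have := (hd _ hi (braidGen_le_braidDelta i)).expSum_le
    rw [expSum_braidGen] at this
    simp [expSum] at this
  have hdpos : d ∈ PosBraid n :=
    mem_posBraid_of_one_le (hd _ (.one_left hx) (.one_left (braidDelta_mem n)))
  obtain ⟨L, ⟨t, ht, ht1, htP, htx, rfl⟩, hmin⟩ := Int.exists_least_of_bdd
    (P := fun z => ∃ t, IsSimple n t ∧ t ≠ 1 ∧ PropP n r J δ t ∧ PrefixLE n t x ∧ expSum t = z)
    ⟨0, by rintro _ ⟨t, ht, _, _, _, rfl⟩; exact expSum_nonneg ht.1⟩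
    ⟨_, d, ⟨hdpos, hdD⟩, hd1, hP.meet (propP_braidDelta hδ) hdx hdD hd, hdx, rfl⟩
  refine ⟨t, ⟨ht, ht1, htP, fun t' ht' ht1' htP' hle => ?_⟩, htx⟩
  exact hle.eq_of_expSum_le (hmin _ ⟨t', ht', ht1', htP', hle.trans htx, rfl⟩)

theorem exists_minSimple_chain (N : ℕ) {δ : Fin r → BraidGroup n} (hδ : CJ n r J δ)
    {x : BraidGroup n} (hN : expSum x < N) (hx : x ∈ PosBraid n) (hP : PropP n r J δ x) :
    ∃ (k : ℕ) (A : Fin (k + 1) → Fin r → BraidGroup n) (s : Fin k → BraidGroup n),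
      A 0 = δ ∧ A (Fin.last k) = (fun i => x⁻¹ * δ i * x) ∧
      (∀ j, CJ n r J (A j) ∧ ∃ ω : BraidGroup n, ∀ i, A j i = ω⁻¹ * δ i * ω) ∧
      (∀ j : Fin k, MinSimple n r J (A j.castSucc) (s j) ∧
        ∀ i, (s j)⁻¹ * A j.castSucc i * s j = A j.succ i) := by
  induction N generalizing δ x with
  | zero => exact absurd hN (by simpa using expSum_nonneg hx)
  | succ N ih =>
    rcases eq_or_ne x 1 with rfl | hx1
    · exact ⟨0, fun _ => δ, Fin.elim0, rfl, by simp, fun _ => ⟨hδ, 1, by simp⟩, fun j => j.elim0⟩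
    obtain ⟨t, ht, y, hy, rfl⟩ := exists_minSimple_le hδ hx hx1 hP
    have htpos : 1 ≤ expSum t := by
      obtain ⟨i, hi⟩ := (posBraid_eq_one_or ht.1.1).resolve_left ht.2.1
      simpa [expSum_braidGen] using hi.expSum_le
    rw [expSum_mul] at hN
    push_cast at hN
    obtain ⟨k, A, s, hA0, hAl, hA, hs⟩ := ih (δ := fun i => t⁻¹ * δ i * t) (x := y) ht.2.2.1
      (by omega) hy fun i => by simpa [mul_assoc] using hP i
    refine ⟨k + 1, Fin.cons δ A, Fin.cons t s, rfl, ?_, ?_, ?_⟩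
    · rw [← Fin.succ_last, Fin.cons_succ, hAl]
      funext i
      simp [mul_assoc]
    · intro j
      refine Fin.cases ⟨hδ, 1, by simp⟩ (fun j => ?_) j
      obtain ⟨hj, ω, hω⟩ := hA j
      exact ⟨hj, t * ω, fun i => by rw [Fin.cons_succ, hω]; simp [mul_assoc]⟩
    · intro j
      refine Fin.cases ⟨ht, fun i => ?_⟩ (fun j => ?_) j
      · rw [Fin.cons_succ, hA0]
        rfl
      · rw [← Fin.succ_castSucc, Fin.cons_succ, Fin.cons_succ, Fin.cons_succ]
        exact hs j

end Garside

/-- if `α` and `β` are simultaneously conjugate and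
`J i = min(inf(αᵢ), inf(βᵢ))`, then `α, β ∈ C_J` and `β` is reachable from `α` by a
chain inside `C_J` of tuples simultaneously conjugate to `α`, where successive tuples
are conjugated by ≼-minimal nontrivial simple elements conjugating the current tuple
into `C_J`. -/
theorem stmt13 (n r : ℕ) (hn : 2 ≤ n) (α β : Fin r → BraidGroup n)
    (x : BraidGroup n) (hconj : ∀ i, x⁻¹ * α i * x = β i)
    (ia ib : Fin r → ℤ)
    (hia : ∀ i, IsGreatest {k : ℤ | InfGE n k (α i)} (ia i))
    (hib : ∀ i, IsGreatest {k : ℤ | InfGE n k (β i)} (ib i))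
    (J : Fin r → ℤ) (hJ : ∀ i, J i = min (ia i) (ib i)) :
    CJ n r J α ∧ CJ n r J β ∧
    ∃ (k : ℕ) (A : Fin (k + 1) → Fin r → BraidGroup n) (s : Fin k → BraidGroup n),
      A 0 = α ∧ A (Fin.last k) = β ∧
      (∀ j, CJ n r J (A j) ∧ ∃ ω : BraidGroup n, ∀ i, A j i = ω⁻¹ * α i * ω) ∧
      (∀ j : Fin k, MinSimple n r J (A j.castSucc) (s j) ∧
        ∀ i, (s j)⁻¹ * A j.castSucc i * s j = A j.succ i) := by
  have hα : CJ n r J α := fun i => InfGE.mono (hia i).1 (by rw [hJ]; exact min_le_left _ _)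
  have hβ : CJ n r J β := fun i => InfGE.mono (hib i).1 (by rw [hJ]; exact min_le_right _ _)
  refine ⟨hα, hβ, ?_⟩
  obtain ⟨k, hk⟩ := exists_sq_braidDelta_mul_mem x
  have hc : ∀ a, ((braidDelta n ^ 2) ^ k)⁻¹ * a * (braidDelta n ^ 2) ^ k = a := fun a => by
    rw [mul_assoc, ← ((commute_sq_braidDelta a).pow_left k).eq, inv_mul_cancel_left]
  have hy : ∀ i, ((braidDelta n ^ 2) ^ k * x)⁻¹ * α i * ((braidDelta n ^ 2) ^ k * x) = β i := by
    intro i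
    rw [← hconj i]
    conv_rhs => rw [← hc (α i)]
    simp only [mul_inv_rev, mul_assoc]
  have hy' : (fun i => ((braidDelta n ^ 2) ^ k * x)⁻¹ * α i * ((braidDelta n ^ 2) ^ k * x)) = β :=
    funext hy
  rw [← hy']
  refine exists_minSimple_chain ((expSum ((braidDelta n ^ 2) ^ k * x)).toNat + 1) hα
    (by push_cast; omega) hk fun i => ?_
  rw [hy i]
  exact hβ i
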